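/- For every ε > 0, D > 0 and every integer m ≥ 1 there are η > 0 and a positive integer M (with M ≥ m) such that every (η,D)-upper-uniform graph G with at least M vertices and at least one edge has an (ε)-regular partition 𝒫 = V₀∪V₁∪…∪V_k with exceptional set V₀ and m ≤ k ≤ M. -/

import Mathlib

open Finset

open Classical in
/-- `e(X,Y)`: the number of edges of `G` with one end in `X` and the other in `Y`
(for disjoint `X`, `Y`). -/
noncomputable def edgesBetween {n : ℕ} (G : SimpleGraph (Fin n)) (X Y : Finset (Fin n)) : ℕ :=
  ((X ×ˢ Y).filter fun xy => G.Adj xy.1 xy.2).card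

/-- `d(X,Y)`: the density of the pair `(X,Y)`. -/
noncomputable def gdens {n : ℕ} (G : SimpleGraph (Fin n)) (X Y : Finset (Fin n)) : ℝ :=
  (edgesBetween G X Y : ℝ) / ((X.card : ℝ) * (Y.card : ℝ))

open Classical in
/-- `e(G)`: the number of edges of `G`. -/
noncomputable def edgeCount {n : ℕ} (G : SimpleGraph (Fin n)) : ℕ :=
  ((Finset.univ : Finset (Sym2 (Fin n))).filter fun e => e ∈ G.edgeSet).card

/-- `d(G) = e(G)/binom(|G|,2)`: the density of `G`. -/
noncomputable def graphDensity {n : ℕ} (G : SimpleGraph (Fin n)) : ℝ :=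
  (edgeCount G : ℝ) / (n.choose 2 : ℝ)

/-- The pair `(X,Y)` is `(ε,p)`-regular in `G`. -/
def PairRegular {n : ℕ} (G : SimpleGraph (Fin n)) (ε p : ℝ) (X Y : Finset (Fin n)) : Prop :=
  ∀ X' ⊆ X, ∀ Y' ⊆ Y, ε * X.card ≤ X'.card → ε * Y.card ≤ Y'.card →
    |gdens G X' Y' - gdens G X Y| < ε * p

/-- A partition of the vertex set with an exceptional set and `k` non-exceptional classes
is encoded as a map `p : Fin n → Fin (k+1)`; class `0` is the exceptional set, and
`classOf p i` is the `i`-th class. -/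
def classOf {n k : ℕ} (p : Fin n → Fin (k + 1)) (i : Fin (k + 1)) : Finset (Fin n) :=
  Finset.univ.filter fun x => p x = i

/-- The partition encoded by `p` (with exceptional class `0`) is balanced: all
non-exceptional classes have equal size. -/
def BalancedP {n k : ℕ} (p : Fin n → Fin (k + 1)) : Prop :=
  ∀ i j : Fin (k + 1), i ≠ 0 → j ≠ 0 → (classOf p i).card = (classOf p j).card

open Classical in
/-- `p` encodes an `(ε)`-regular partition of `G` with exceptional set the class `0`:
it is balanced, the exceptional set has size `< ε·n`, and all but at most `ε·k²` of the
pairs `(Vᵢ,Vⱼ)` with `i > j ≥ 1` are `(ε,d)`-regular, where `d` is the density of `G`. -/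
def ScaledEpsRegularGraphPartition {n k : ℕ} (G : SimpleGraph (Fin n)) (ε : ℝ)
    (p : Fin n → Fin (k + 1)) : Prop :=
  BalancedP p ∧ ((classOf p 0).card : ℝ) < ε * n ∧
  ((((Finset.univ : Finset (Fin (k + 1) × Fin (k + 1))).filter fun ij =>
      ij.2 ≠ 0 ∧ ij.2 < ij.1 ∧
      ¬ PairRegular G ε (graphDensity G) (classOf p ij.1) (classOf p ij.2)).card : ℝ)
    ≤ ε * (k : ℝ) ^ 2)

/-- `G` is `(η,D)`-upper-uniform: for all disjoint `X, Y ⊆ V(G)` with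
`min{|X|,|Y|} ≥ η·|G|`, the density `d(X,Y)` is at most `D·d(G)`. -/
def UpperUniform {n : ℕ} (G : SimpleGraph (Fin n)) (η D : ℝ) : Prop :=
  ∀ X Y : Finset (Fin n), Disjoint X Y → η * n ≤ X.card → η * n ≤ Y.card →
    gdens G X Y ≤ D * graphDensity G

lemma graphDensity_nonneg {n : ℕ} (G : SimpleGraph (Fin n)) : 0 ≤ graphDensity G := by
  unfold graphDensity; positivity

lemma gdens_nonneg {n : ℕ} (G : SimpleGraph (Fin n)) (X Y : Finset (Fin n)) :
    0 ≤ gdens G X Y := by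
  unfold gdens; positivity

open Classical in
lemma graphDensity_pos {n : ℕ} {G : SimpleGraph (Fin n)} (h : ∃ x y, G.Adj x y) :
    0 < graphDensity G := by
  obtain ⟨x, y, hxy⟩ := h
  have hn : 2 ≤ n := by
    have h1 := x.isLt
    have h2 := y.isLt
    have h3 : x.val ≠ y.val := fun h => hxy.ne (Fin.ext h)
    omega
  have he : 0 < edgeCount G :=
    Finset.card_pos.2 ⟨s(x, y), by simpa using hxy⟩
  have hc : 0 < n.choose 2 := Nat.choose_pos hn
  unfold graphDensity
  positivity

lemma PairRegular.mono {n : ℕ} {G : SimpleGraph (Fin n)} {ε ε' p : ℝ} {X Y : Finset (Fin n)}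
    (h : PairRegular G ε' p X Y) (hp : 0 ≤ p) (hε : ε' ≤ ε) : PairRegular G ε p X Y := by
  intro X' hX Y' hY h1 h2
  have := h X' hX Y' hY ((mul_le_mul_of_nonneg_right hε (Nat.cast_nonneg _)).trans h1)
    ((mul_le_mul_of_nonneg_right hε (Nat.cast_nonneg _)).trans h2)
  exact this.trans_le (mul_le_mul_of_nonneg_right hε hp)

lemma ScaledEpsRegularGraphPartition.mono {n k : ℕ} {G : SimpleGraph (Fin n)} {ε ε' : ℝ}
    {p : Fin n → Fin (k + 1)} (h : ScaledEpsRegularGraphPartition G ε' p) (hε : ε' ≤ ε) :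
    ScaledEpsRegularGraphPartition G ε p := by
  refine ⟨h.1, h.2.1.trans_le (mul_le_mul_of_nonneg_right hε (Nat.cast_nonneg _)), ?_⟩
  refine le_trans ?_ (h.2.2.trans (mul_le_mul_of_nonneg_right hε (by positivity)))
  refine Nat.cast_le.2 (Finset.card_le_card fun ij => ?_)
  simp only [Finset.mem_filter, Finset.mem_univ, true_and]
  rintro ⟨h1, h2, h3⟩
  exact ⟨h1, h2, fun h4 => h3 (h4.mono (graphDensity_nonneg G) hε)⟩

lemma UpperUniform.mono {n : ℕ} {G : SimpleGraph (Fin n)} {η η' D : ℝ}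
    (h : UpperUniform G η D) (hη : η ≤ η') : UpperUniform G η' D := fun X Y hd h1 h2 =>
  h X Y hd ((mul_le_mul_of_nonneg_right hη (Nat.cast_nonneg _)).trans h1)
    ((mul_le_mul_of_nonneg_right hη (Nat.cast_nonneg _)).trans h2)

open Classical in
/-- The adjacency indicator of `G` as a real-valued function on pairs of vertices. -/
noncomputable def adjInd {n : ℕ} (G : SimpleGraph (Fin n)) (z : Fin n × Fin n) : ℝ :=
  if G.Adj z.1 z.2 then 1 else 0

lemma adjInd_nonneg {n : ℕ} (G : SimpleGraph (Fin n)) (z : Fin n × Fin n) : 0 ≤ adjInd G z := by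
  unfold adjInd; split_ifs <;> norm_num

lemma sum_adjInd {n : ℕ} (G : SimpleGraph (Fin n)) (X Y : Finset (Fin n)) :
    ∑ z ∈ X ×ˢ Y, adjInd G z = X.card * Y.card * gdens G X Y := by
  have h : ∑ z ∈ X ×ˢ Y, adjInd G z = edgesBetween G X Y := by
    simp [adjInd, edgesBetween]
  rw [h, gdens]
  by_cases h0 : (X.card : ℝ) * Y.card = 0
  · have h1 : X ×ˢ Y = ∅ := by
      rw [← Finset.card_eq_zero, Finset.card_product]
      exact_mod_cast h0
    simp [edgesBetween, h1]
  · rw [mul_div_cancel₀ _ h0]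

open Classical in
lemma sum_adjInd_univ {n : ℕ} (G : SimpleGraph (Fin n)) :
    ∑ z, adjInd G z = graphDensity G * (n * (n - 1)) := by
  have h1 : ∑ z, adjInd G z = ((2 * edgeCount G : ℕ) : ℝ) := by
    have h2 : edgeCount G = G.edgeFinset.card := by
      unfold edgeCount
      congr 1
      ext e
      simp
    rw [h2, ← G.sum_degrees_eq_twice_card_edges, Fintype.sum_prod_type, Nat.cast_sum]
    refine Finset.sum_congr rfl fun u _ => ?_
    simp [adjInd, ← SimpleGraph.card_neighborFinset_eq_degree, SimpleGraph.neighborFinset_eq_filter]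
  rw [h1, graphDensity]
  by_cases hn : n.choose 2 = 0
  · have h2 : n < 2 := by
      by_contra h
      exact (Nat.choose_pos (not_lt.1 h)).ne' hn
    have h3 : edgeCount G = 0 := by
      unfold edgeCount
      rw [Finset.card_eq_zero, Finset.filter_eq_empty_iff]
      intro e _
      induction e with | _ x y =>
      intro he
      have h1 := x.isLt
      have h2 := y.isLt
      have h3 : x.val ≠ y.val := fun h => (G.ne_of_adj he) (Fin.ext h)
      omega
    simp [h3]
  · have h3 : (n.choose 2 : ℝ) ≠ 0 := by exact_mod_cast hn
    have h4 : (n : ℝ) * (n - 1) = 2 * n.choose 2 := by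
      rw [Nat.cast_choose_two]; ring
    rw [h4]
    push_cast
    field_simp

/-- The correlation of `t` with the adjacency indicator, penalised by the square of `t`.
On a block of pairs it is maximised, among constants, by the density of the block. -/
noncomputable def score {n : ℕ} (G : SimpleGraph (Fin n)) (t : Fin n × Fin n → ℝ)
    (z : Fin n × Fin n) : ℝ :=
  2 * t z * adjInd G z - t z ^ 2

lemma sum_score_le {n : ℕ} {G : SimpleGraph (Fin n)} {D : ℝ} (hD : 0 < D)
    {t : Fin n × Fin n → ℝ} (ht : ∀ z, t z ≤ D * graphDensity G) :
    ∑ z, score G t z ≤ 2 * D * (graphDensity G * n) ^ 2 := by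
  have hd := graphDensity_nonneg G
  have h1 : ∑ z, score G t z ≤ ∑ z, 2 * (D * graphDensity G) * adjInd G z := by
    refine Finset.sum_le_sum fun z _ => ?_
    unfold score
    nlinarith [mul_le_mul_of_nonneg_right (ht z) (adjInd_nonneg G z), sq_nonneg (t z)]
  rw [← Finset.mul_sum, sum_adjInd_univ] at h1
  refine h1.trans ?_
  have h2 : 0 ≤ D * graphDensity G ^ 2 * n := by positivity
  nlinarith

lemma sum_score_const_le {n : ℕ} (G : SimpleGraph (Fin n)) (X Y : Finset (Fin n)) (s : ℝ)
    {t : Fin n × Fin n → ℝ} (ht : ∀ z ∈ X ×ˢ Y, t z = s) :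
    ∑ z ∈ X ×ˢ Y, score G t z ≤ X.card * Y.card * gdens G X Y ^ 2 := by
  have h1 : ∑ z ∈ X ×ˢ Y, score G t z = ∑ z ∈ X ×ˢ Y, (2 * s * adjInd G z - s ^ 2) :=
    Finset.sum_congr rfl fun z hz => by rw [score, ht z hz]
  rw [h1, Finset.sum_sub_distrib, ← Finset.mul_sum, sum_adjInd]
  simp only [Finset.sum_const, Finset.card_product, nsmul_eq_mul, Nat.cast_mul]
  have : 0 ≤ (X.card : ℝ) * Y.card * (gdens G X Y - s) ^ 2 := by positivity
  nlinarith

open Classical in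
lemma sum_score_ite {n : ℕ} (G : SimpleGraph (Fin n)) {X Y X' Y' : Finset (Fin n)}
    (hX : X' ⊆ X) (hY : Y' ⊆ Y) {t : Fin n × Fin n → ℝ}
    (ht : ∀ z ∈ X ×ˢ Y, t z = if z.1 ∈ X' ∧ z.2 ∈ Y' then gdens G X' Y' else gdens G X Y) :
    ∑ z ∈ X ×ˢ Y, score G t z = X.card * Y.card * gdens G X Y ^ 2 +
      X'.card * Y'.card * (gdens G X' Y' - gdens G X Y) ^ 2 := by
  set a := gdens G X Y
  set b := gdens G X' Y'
  have h1 : ∑ z ∈ X ×ˢ Y, score G t z = ∑ z ∈ X ×ˢ Y, ((2 * a * adjInd G z - a ^ 2) +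
      if z.1 ∈ X' ∧ z.2 ∈ Y' then 2 * (b - a) * adjInd G z - (b ^ 2 - a ^ 2) else 0) :=
    Finset.sum_congr rfl fun z hz => by
      rw [score, ht z hz]
      split_ifs <;> ring
  have h2 : (X ×ˢ Y).filter (fun z => z.1 ∈ X' ∧ z.2 ∈ Y') = X' ×ˢ Y' := by
    ext z
    simp only [Finset.mem_filter, Finset.mem_product]
    exact ⟨fun h => h.2, fun h => ⟨⟨hX h.1, hY h.2⟩, h⟩⟩
  rw [h1, Finset.sum_add_distrib, ← Finset.sum_filter, h2, Finset.sum_sub_distrib,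
    Finset.sum_sub_distrib, ← Finset.mul_sum, ← Finset.mul_sum, sum_adjInd, sum_adjInd]
  simp only [Finset.sum_const, Finset.card_product, nsmul_eq_mul, Nat.cast_mul]
  ring

lemma sum_eq_sum_blocks {n k : ℕ} (p : Fin n → Fin (k + 1)) (f : Fin n × Fin n → ℝ) :
    ∑ z, f z = ∑ ij : Fin (k + 1) × Fin (k + 1), ∑ z ∈ classOf p ij.1 ×ˢ classOf p ij.2, f z := by
  rw [← Finset.sum_fiberwise Finset.univ (fun z : Fin n × Fin n => (p z.1, p z.2)) f]
  refine Finset.sum_congr rfl fun ij _ => Finset.sum_congr ?_ fun _ _ => rfl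
  ext z
  simp [classOf, Prod.ext_iff]

/-- Greedily cutting the fibres of `σ` outside `J` into classes of size `c`. -/
lemma exists_equal_chunks {n c : ℕ} (hc : 0 < c) {S : Type*} [Fintype S] (σ : Fin n → S)
    (J : Finset (Fin n)) :
    ∃ (k : ℕ) (q : Fin n → Fin (k + 1)), (∀ i, i ≠ 0 → (classOf q i).card = c) ∧
      (∀ u v, q u = q v → q u ≠ 0 → σ u = σ v) ∧ (∀ u ∈ J, q u = 0) ∧
      (classOf q 0).card ≤ J.card + Fintype.card S * c := by
  classical
  induction hr : Jᶜ.card using Nat.strong_induction_on generalizing J with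
  | _ r ih =>
  by_cases h : ∃ s, c ≤ (Jᶜ.filter fun u => σ u = s).card
  · obtain ⟨s, hs⟩ := h
    obtain ⟨A, hA, hAc⟩ := Finset.exists_subset_card_eq hs
    have hAJ : ∀ u ∈ A, u ∉ J := fun u hu => by
      simpa using (Finset.mem_filter.1 (hA hu)).1
    have hAs : ∀ u ∈ A, σ u = s := fun u hu => (Finset.mem_filter.1 (hA hu)).2
    have hdis : Disjoint J A := Finset.disjoint_right.2 hAJ
    have hJA : (J ∪ A).card = J.card + c := by
      rw [Finset.card_union_of_disjoint hdis, hAc]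
    obtain ⟨k, q, h1, h2, h3, h4⟩ := ih (J ∪ A)ᶜ.card (by
      have h5 := Finset.card_le_univ (J ∪ A)
      rw [← hr, Finset.card_compl, Finset.card_compl]
      omega) (J ∪ A) rfl
    have hq0 : ∀ u ∈ A, q u = 0 := fun u hu => h3 u (Finset.mem_union_right _ hu)
    refine ⟨k + 1, fun u => if u ∈ A then Fin.last _ else (q u).castSucc, ?_, ?_, ?_, ?_⟩
    · intro i
      refine Fin.lastCases ?_ (fun i => ?_) i
      · intro _
        rw [← hAc]
        congr 1
        ext u
        by_cases hu : u ∈ A <;> simp [classOf, hu, Fin.castSucc_ne_last]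
      · intro hi
        have hi' : i ≠ 0 := fun h => hi (by simp [h])
        rw [← h1 i hi']
        congr 1
        ext u
        by_cases hu : u ∈ A
        · simp [classOf, hu, hq0 u hu, hi'.symm, (Fin.castSucc_ne_last i).symm]
        · simp [classOf, hu]
    · intro u v
      by_cases hu : u ∈ A <;> by_cases hv : v ∈ A
      · intro _ _
        rw [hAs u hu, hAs v hv]
      · simp [hu, hv, (Fin.castSucc_ne_last (q v)).symm]
      · simp [hu, hv, Fin.castSucc_ne_last (q u)]
      · simp only [hu, hv, if_false]
        intro h5 h6
        exact h2 u v (Fin.castSucc_injective _ h5) fun h => h6 (by simp [h])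
    · intro u hu
      have : u ∉ A := fun h => hAJ u h hu
      simp [this, h3 u (Finset.mem_union_left _ hu)]
    · have h5 : classOf (fun u => if u ∈ A then Fin.last (k + 1) else (q u).castSucc) 0 =
          classOf q 0 \ A := by
        ext u
        by_cases hu : u ∈ A
        · simp [classOf, hu, Fin.last_eq_zero_iff]
        · simp [classOf, hu, Fin.castSucc_eq_zero_iff]
      have h6 : A ⊆ classOf q 0 := fun u hu => by simp [classOf, hq0 u hu]
      rw [h5, Finset.card_sdiff_of_subset h6]
      omega
  · push Not at h
    refine ⟨0, fun _ => 0, fun i hi => absurd (Fin.fin_one_eq_zero i) hi, fun _ _ _ h => absurd rfl h,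
      fun _ _ => rfl, ?_⟩
    have h1 : Jᶜ.card ≤ Fintype.card S * c := by
      rw [Finset.card_eq_sum_card_fiberwise (f := σ) (t := Finset.univ) (fun _ _ => by simp)]
      refine (Finset.sum_le_card_nsmul _ _ c fun s _ => (h s).le).trans ?_
      simp [Finset.card_univ]
    have h2 := Finset.card_compl_add_card J
    refine (Finset.card_le_univ _).trans ?_
    omega

lemma card_classOf_zero_add {n k c : ℕ} {p : Fin n → Fin (k + 1)}
    (hp : ∀ i, i ≠ 0 → (classOf p i).card = c) : (classOf p 0).card + k * c = n := by
  have h := Finset.card_eq_sum_card_fiberwise (f := p) (s := Finset.univ) (t := Finset.univ)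
    (fun _ _ => by simp)
  change _ = ∑ i, (classOf p i).card at h
  rw [Fin.sum_univ_succ, Finset.sum_congr rfl fun i _ => hp i.succ (Fin.succ_ne_zero i)] at h
  simpa [classOf] using h.symm

lemma exists_balanced_refinement {n N : ℕ} {β δ : ℝ} (hN : 0 < N) (hβ : 0 ≤ β) (hδ : 0 < δ)
    (hβδ : β + δ ≤ 1 / 2) (hn : N / δ ≤ n) {S : Type*} [Fintype S] (hS : Fintype.card S ≤ N)
    (σ : Fin n → S) (J : Finset (Fin n)) (hJ : (J.card : ℝ) ≤ β * n) :
    ∃ (k c : ℕ) (q : Fin n → Fin (k + 1)), N ≤ k ∧ (k : ℝ) ≤ 2 * N / δ ∧ 0 < c ∧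
      (∀ i, i ≠ 0 → (classOf q i).card = c) ∧
      (∀ u v, q u = q v → q u ≠ 0 → σ u = σ v) ∧ (∀ u ∈ J, q u = 0) ∧
      ((classOf q 0).card : ℝ) ≤ (β + δ) * n := by
  have hNr : (0 : ℝ) < N := Nat.cast_pos.2 hN
  have h1 : 1 ≤ δ * n / N := by
    rw [le_div_iff₀ hNr]
    rw [div_le_iff₀ hδ] at hn
    linarith
  set c := ⌊δ * n / N⌋₊ with hcdef
  have hc : 0 < c := Nat.floor_pos.2 h1
  have hc1 : (1 : ℝ) ≤ c := by exact_mod_cast hc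
  have hle : (c : ℝ) ≤ δ * n / N := Nat.floor_le (by positivity)
  have hlt : δ * n / N < c + 1 := Nat.lt_floor_add_one _
  rw [le_div_iff₀ hNr] at hle
  rw [div_lt_iff₀ hNr] at hlt
  obtain ⟨k, q, h2, h3, h4, h5⟩ := exists_equal_chunks hc σ J
  have h6 := card_classOf_zero_add h2
  have h6r : ((classOf q 0).card : ℝ) + k * c = n := by exact_mod_cast h6
  have h5r : ((classOf q 0).card : ℝ) ≤ J.card + N * c := by
    have : ((classOf q 0).card : ℝ) ≤ J.card + Fintype.card S * c := by exact_mod_cast h5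
    have h7 : (Fintype.card S : ℝ) ≤ N := by exact_mod_cast hS
    nlinarith
  have hV : ((classOf q 0).card : ℝ) ≤ (β + δ) * n := by linarith
  have hn0 : (0 : ℝ) ≤ n := Nat.cast_nonneg _
  refine ⟨k, c, q, ?_, ?_, hc, h2, h3, h4, hV⟩
  · have h8 : (N : ℝ) * c ≤ k * c := by nlinarith
    exact_mod_cast le_of_mul_le_mul_right h8 (by linarith)
  · rw [le_div_iff₀ hδ]
    have h9 : (k : ℝ) * c ≤ n := by
      have : (0 : ℝ) ≤ (classOf q 0).card := Nat.cast_nonneg _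
      linarith
    have h10 : (k * δ) * c ≤ (2 * N) * (c : ℝ) := by nlinarith
    exact le_of_mul_le_mul_right h10 (by linarith)

/-- A balanced partition with between `m` and `M` classes and exceptional set of size at most
`β n`, with a `[0, D d]`-valued function that is constant on the blocks of the partition and
has total score at least `g (d n)²`. -/
def HasScoredPartition {n : ℕ} (G : SimpleGraph (Fin n)) (D β g : ℝ) (m M : ℕ) : Prop :=
  ∃ (k c : ℕ) (p : Fin n → Fin (k + 1)) (t : Fin n × Fin n → ℝ),
    m ≤ k ∧ k ≤ M ∧ 0 < c ∧ (∀ i, i ≠ 0 → (classOf p i).card = c) ∧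
    ((classOf p 0).card : ℝ) ≤ β * n ∧ (∀ z, 0 ≤ t z ∧ t z ≤ D * graphDensity G) ∧
    (∀ z w : Fin n × Fin n, p z.1 = p w.1 → p z.2 = p w.2 → p z.1 ≠ 0 → p z.2 ≠ 0 → t z = t w) ∧
    g * (graphDensity G * n) ^ 2 ≤ ∑ z, score G t z

lemma hasScoredPartition_zero {n m M : ℕ} (G : SimpleGraph (Fin n)) {D β : ℝ} (hD : 0 < D)
    (hβ : 0 < β) (hβ' : β ≤ 1 / 2) (hm : 1 ≤ m) (hn : m / β ≤ n) (hM : 2 * m / β ≤ M) :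
    HasScoredPartition G D β 0 m M := by
  obtain ⟨k, c, q, h1, h2, hc, h3, h4, h5, h6⟩ := exists_balanced_refinement (n := n) (N := m)
    (β := 0) (δ := β) hm le_rfl hβ (by linarith) hn (S := Unit) (by simpa using hm)
    (fun _ => ()) ∅ (by simp)
  refine ⟨k, c, q, 0, h1, by exact_mod_cast h2.trans hM, hc, h3, by simpa using h6, ?_, ?_, ?_⟩
  · intro z
    have := graphDensity_nonneg G
    simp only [Pi.zero_apply]
    exact ⟨le_rfl, by positivity⟩
  · intros; rfl
  · simp [score]

/-- An upper bound for the number of atoms generated by the witnesses of irregularity of a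
partition into at most `M` classes. -/
def atomBound (M : ℕ) : ℕ := (M + 1) * ((2 * 2) ^ (M + 1)) ^ (M + 1)

lemma atomBound_mono {k M : ℕ} (h : k ≤ M) : atomBound k ≤ atomBound M := by
  unfold atomBound
  have h1 : k + 1 ≤ M + 1 := by omega
  gcongr
  · exact Nat.one_le_pow _ _ (by norm_num)
  · norm_num

lemma le_atomBound (M : ℕ) : M + 1 ≤ atomBound M := by
  unfold atomBound
  exact Nat.le_mul_of_pos_right _ (by positivity)

open Classical in
lemma HasScoredPartition.regular_or_increment {n m M M' : ℕ} {G : SimpleGraph (Fin n)}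
    {ε η D β β' g : ℝ} (hε : 0 < ε) (hε' : ε ≤ 1 / 2) (hβ : 0 ≤ β) (hββ : β < β')
    (hβε : β' < ε) (hM : 1 ≤ M) (hη : η ≤ ε / (2 * M))
    (hn : atomBound M / (β' - β) ≤ n) (hM' : 2 * atomBound M / (β' - β) ≤ M')
    (hG : UpperUniform G η D) (hedge : ∃ x y, G.Adj x y) (hp : HasScoredPartition G D β g m M) :
    (∃ (k : ℕ) (p : Fin n → Fin (k + 1)),
      m ≤ k ∧ k ≤ M ∧ ScaledEpsRegularGraphPartition G ε p) ∨
    HasScoredPartition G D β' (g + ε ^ 5 / 4) m M' := by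
  obtain ⟨k, c, p, t, hmk, hkM, hc, hcard, hV0, ht, htc, hg⟩ := hp
  have hd := graphDensity_pos hedge
  set d := graphDensity G with hddef
  have hn0 : (0 : ℝ) < n := by
    obtain ⟨x, -⟩ := hedge
    exact_mod_cast x.pos
  have hMr : (1 : ℝ) ≤ M := by exact_mod_cast hM
  have hcr : (0 : ℝ) < c := by exact_mod_cast hc
  have hsize : ((classOf p 0).card : ℝ) + k * c = n := by
    exact_mod_cast card_classOf_zero_add hcard
  have hkc : (n : ℝ) / 2 ≤ k * c := by nlinarith
  have hηc : η * n ≤ ε * c := by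
    have h1 : (k : ℝ) * c ≤ M * c := by gcongr
    calc η * n ≤ ε / (2 * M) * n := by gcongr
      _ ≤ ε / (2 * M) * (2 * (M * c)) := by gcongr; linarith
      _ = ε * c := by field_simp
  set Bad : Finset (Fin (k + 1) × Fin (k + 1)) := Finset.univ.filter fun ij =>
      ij.2 ≠ 0 ∧ ij.2 < ij.1 ∧ ¬ PairRegular G ε d (classOf p ij.1) (classOf p ij.2) with hBad
  by_cases hreg : (Bad.card : ℝ) ≤ ε * (k : ℝ) ^ 2
  · left
    refine ⟨k, p, hmk, hkM, fun i j hi hj => by rw [hcard i hi, hcard j hj], ?_, hreg⟩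
    exact hV0.trans_lt (mul_lt_mul_of_pos_right (hββ.trans hβε) hn0)
  right
  push Not at hreg
  have hwit : ∀ ij : Fin (k + 1) × Fin (k + 1), ∃ XY : Finset (Fin n) × Finset (Fin n),
      ij ∈ Bad → XY.1 ⊆ classOf p ij.1 ∧ XY.2 ⊆ classOf p ij.2 ∧ ε * c ≤ XY.1.card ∧
        ε * c ≤ XY.2.card ∧
        ε * d ≤ |gdens G XY.1 XY.2 - gdens G (classOf p ij.1) (classOf p ij.2)| := by
    intro ij
    by_cases h : ij ∈ Bad
    · obtain ⟨h1, h2, h3⟩ := (Finset.mem_filter.1 h).2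
      unfold PairRegular at h3
      push Not at h3
      obtain ⟨X, hX, Y, hY, h4, h5, h6⟩ := h3
      rw [hcard _ (ne_bot_of_gt h2)] at h4
      rw [hcard _ h1] at h5
      exact ⟨(X, Y), fun _ => ⟨hX, hY, h4, h5, h6⟩⟩
    · exact ⟨(∅, ∅), fun h' => absurd h' h⟩
  choose W hW using hwit
  have hBad' : ∀ ij ∈ Bad, ij.1 ≠ 0 ∧ ij.2 ≠ 0 ∧ ij.1 ≠ ij.2 := fun ij h => by
    obtain ⟨h1, h2, -⟩ := (Finset.mem_filter.1 h).2
    exact ⟨ne_bot_of_gt h2, h1, h2.ne'⟩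
  have hdisj : ∀ ij ∈ Bad, Disjoint (classOf p ij.1) (classOf p ij.2) := fun ij h => by
    refine Finset.disjoint_left.2 fun u hu hu' => (hBad' ij h).2.2 ?_
    rw [← (Finset.mem_filter.1 hu).2, (Finset.mem_filter.1 hu').2]
  have hle : ∀ ij ∈ Bad, gdens G (classOf p ij.1) (classOf p ij.2) ≤ D * d := fun ij h => by
    refine hG _ _ (hdisj ij h) ?_ ?_
    · rw [hcard _ (hBad' ij h).1]; nlinarith
    · rw [hcard _ (hBad' ij h).2.1]; nlinarith
  have hleW : ∀ ij ∈ Bad, gdens G (W ij).1 (W ij).2 ≤ D * d := fun ij h => by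
    obtain ⟨h1, h2, h3, h4, -⟩ := hW ij h
    exact hG _ _ (Finset.disjoint_of_subset_left h1 (Finset.disjoint_of_subset_right h2
      (hdisj ij h))) (hηc.trans h3) (hηc.trans h4)
  let σ : Fin n → Fin (k + 1) × (Fin (k + 1) → Fin (k + 1) → Bool × Bool) := fun u =>
    (p u, fun i j => (decide (u ∈ (W (i, j)).1), decide (u ∈ (W (i, j)).2)))
  have hσ : ∀ u v, σ u = σ v → p u = p v ∧
      ∀ ij, (u ∈ (W ij).1 ↔ v ∈ (W ij).1) ∧ (u ∈ (W ij).2 ↔ v ∈ (W ij).2) := by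
    intro u v h
    refine ⟨congrArg Prod.fst h, fun ij => ?_⟩
    have h1 := congrFun (congrFun (congrArg Prod.snd h) ij.1) ij.2
    simpa [σ] using h1
  clear_value σ
  have hAM : 0 < atomBound M := lt_of_lt_of_le (Nat.succ_pos M) (le_atomBound M)
  obtain ⟨k', c', q, h1, h2, hc', h3, h4, h5, h6⟩ := exists_balanced_refinement (n := n)
    hAM hβ (sub_pos.2 hββ) (by linarith) hn
    (S := Fin (k + 1) × (Fin (k + 1) → Fin (k + 1) → Bool × Bool))
    (by simpa [atomBound] using atomBound_mono hkM) σ (classOf p 0) hV0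
  have hq0 : ∀ u, q u ≠ 0 → p u ≠ 0 := fun u hu h => hu (h5 u (by simp [classOf, h]))
  let t' : Fin n × Fin n → ℝ := fun z =>
    if (p z.1, p z.2) ∈ Bad then
      if z.1 ∈ (W (p z.1, p z.2)).1 ∧ z.2 ∈ (W (p z.1, p z.2)).2 then
        gdens G (W (p z.1, p z.2)).1 (W (p z.1, p z.2)).2
      else gdens G (classOf p (p z.1)) (classOf p (p z.2))
    else t z
  refine ⟨k', c', q, t', by have := le_atomBound M; omega, by exact_mod_cast h2.trans hM', hc', h3,
    by simpa using h6, ?_, ?_, ?_⟩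
  · intro z
    simp only [t']
    split_ifs with hb hw
    · exact ⟨gdens_nonneg _ _ _, hleW (p z.1, p z.2) hb⟩
    · exact ⟨gdens_nonneg _ _ _, hle (p z.1, p z.2) hb⟩
    · exact ht z
  · intro z w hz1 hz2 hz3 hz4
    obtain ⟨e1, e2⟩ := hσ z.1 w.1 (h4 z.1 w.1 hz1 hz3)
    obtain ⟨e3, e4⟩ := hσ z.2 w.2 (h4 z.2 w.2 hz2 hz4)
    have e5 := htc z w e1 e3 (hq0 z.1 hz3) (hq0 z.2 hz4)
    simp only [t', e1, e3, e5, (e2 _).1, (e4 _).2]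
  · have hblock : ∀ ij : Fin (k + 1) × Fin (k + 1),
        (∑ z ∈ classOf p ij.1 ×ˢ classOf p ij.2, score G t z) +
          (if ij ∈ Bad then (ε * c) * (ε * c) * (ε * d) ^ 2 else 0) ≤
        ∑ z ∈ classOf p ij.1 ×ˢ classOf p ij.2, score G t' z := by
      intro ij
      have hmem : ∀ z ∈ classOf p ij.1 ×ˢ classOf p ij.2, p z.1 = ij.1 ∧ p z.2 = ij.2 :=
        fun z hz => by simpa [classOf] using hz
      by_cases hb : ij ∈ Bad
      · obtain ⟨w1, w2, w3, w4, w5⟩ := hW ij hb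
        rw [if_pos hb, sum_score_ite G w1 w2 (t := t') (fun z hz => by
          obtain ⟨e1, e2⟩ := hmem z hz
          simp only [t', e1, e2, hb, if_true])]
        refine add_le_add ?_ ?_
        · have hne1 : (classOf p ij.1).Nonempty :=
            Finset.card_pos.1 (by rw [hcard _ (hBad' ij hb).1]; exact hc)
          have hne2 : (classOf p ij.2).Nonempty :=
            Finset.card_pos.1 (by rw [hcard _ (hBad' ij hb).2.1]; exact hc)
          obtain ⟨u, hu⟩ := hne1
          obtain ⟨v, hv⟩ := hne2
          refine sum_score_const_le G _ _ (t (u, v)) fun z hz => ?_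
          obtain ⟨e1, e2⟩ := hmem z hz
          obtain ⟨e3, e4⟩ := hmem (u, v) (Finset.mk_mem_product hu hv)
          exact htc z (u, v) (e1.trans e3.symm) (e2.trans e4.symm)
            (e1 ▸ (hBad' ij hb).1) (e2 ▸ (hBad' ij hb).2.1)
        · rw [← sq_abs (gdens G (W ij).1 (W ij).2 - _)]
          gcongr
      · rw [if_neg hb, add_zero]
        refine le_of_eq (Finset.sum_congr rfl fun z hz => ?_)
        obtain ⟨e1, e2⟩ := hmem z hz
        simp only [score, t', e1, e2, hb, if_false]
    have hsum := Finset.sum_le_sum fun ij (_ : ij ∈ Finset.univ) => hblock ij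
    rw [Finset.sum_add_distrib, ← sum_eq_sum_blocks, ← sum_eq_sum_blocks,
      Finset.sum_ite_mem, Finset.univ_inter, Finset.sum_const, nsmul_eq_mul] at hsum
    have hgain : ε ^ 5 / 4 * (d * n) ^ 2 ≤ Bad.card * ((ε * c) * (ε * c) * (ε * d) ^ 2) := by
      calc ε ^ 5 / 4 * (d * n) ^ 2 = ε ^ 5 * d ^ 2 * (n / 2) ^ 2 := by ring
        _ ≤ ε ^ 5 * d ^ 2 * (k * c) ^ 2 := by gcongr
        _ = ε * k ^ 2 * ((ε * c) * (ε * c) * (ε * d) ^ 2) := by ring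
        _ ≤ _ := by gcongr
    linarith

lemma regular_or_scored_partition {ε D : ℝ} (hε : 0 < ε) (hε' : ε ≤ 1 / 2) (hD : 0 < D)
    {m : ℕ} (hm : 1 ≤ m) (T : ℕ) :
    ∃ (η β : ℝ) (M : ℕ), 0 < η ∧ 0 < β ∧ β < ε ∧ m ≤ M ∧
      ∀ n : ℕ, M ≤ n → ∀ G : SimpleGraph (Fin n),
        UpperUniform G η D → (∃ x y, G.Adj x y) →
        (∃ (k : ℕ) (p : Fin n → Fin (k + 1)),
          m ≤ k ∧ k ≤ M ∧ ScaledEpsRegularGraphPartition G ε p) ∨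
        HasScoredPartition G D β (T * (ε ^ 5 / 4)) m M := by
  induction T with
  | zero =>
    have hb : 0 < ε / 2 := by linarith
    have hle : (2 * m / (ε / 2) : ℝ) ≤ ⌈(2 * m / (ε / 2) : ℝ)⌉₊ := Nat.le_ceil _
    refine ⟨1, ε / 2, max m ⌈(2 * m / (ε / 2) : ℝ)⌉₊, one_pos, hb, by linarith, le_max_left _ _,
      fun n hn G _ _ => Or.inr ?_⟩
    have hle' : (2 * m / (ε / 2) : ℝ) ≤ (max m ⌈(2 * m / (ε / 2) : ℝ)⌉₊ : ℕ) :=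
      hle.trans (Nat.cast_le.2 (le_max_right _ _))
    have hn' : (2 * m / (ε / 2) : ℝ) ≤ n := hle'.trans (Nat.cast_le.2 hn)
    rw [Nat.cast_zero, zero_mul]
    refine hasScoredPartition_zero G hD hb (by linarith) hm (le_trans ?_ hn') hle'
    gcongr
    have : (0 : ℝ) ≤ m := Nat.cast_nonneg _
    linarith
  | succ T ih =>
    obtain ⟨η, β, M, hη, hβ, hβε, hmM, h⟩ := ih
    have hM : 1 ≤ M := hm.trans hmM
    have hMr : (0 : ℝ) < M := by exact_mod_cast hM
    have hgap : 0 < (β + ε) / 2 - β := by linarith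
    set B : ℝ := 2 * atomBound M / ((β + ε) / 2 - β) with hB
    refine ⟨min η (ε / (2 * M)), (β + ε) / 2, max M ⌈B⌉₊, lt_min hη (by positivity),
      by linarith, by linarith, hmM.trans (le_max_left _ _), fun n hn G hG hedge => ?_⟩
    have hM' : B ≤ (max M ⌈B⌉₊ : ℕ) :=
      (Nat.le_ceil _).trans (Nat.cast_le.2 (le_max_right _ _))
    have hn' : B ≤ n := hM'.trans (Nat.cast_le.2 hn)
    have weaken : (∃ (k : ℕ) (p : Fin n → Fin (k + 1)),
          m ≤ k ∧ k ≤ M ∧ ScaledEpsRegularGraphPartition G ε p) →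
        ∃ (k : ℕ) (p : Fin n → Fin (k + 1)),
          m ≤ k ∧ k ≤ max M ⌈B⌉₊ ∧ ScaledEpsRegularGraphPartition G ε p :=
      fun ⟨k, p, h1, h2, h3⟩ => ⟨k, p, h1, h2.trans (le_max_left _ _), h3⟩
    rcases h n ((le_max_left _ _).trans hn) G (hG.mono (min_le_left _ _)) hedge with h1 | h1
    · exact Or.inl (weaken h1)
    have hA : (atomBound M / ((β + ε) / 2 - β) : ℝ) ≤ n := by
      refine le_trans ?_ hn'
      rw [hB]
      gcongr
      have : (0 : ℝ) ≤ atomBound M := Nat.cast_nonneg _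
      linarith
    refine (h1.regular_or_increment hε hε' hβ.le (by linarith) (by linarith) hM
      (min_le_right _ _) hA hM' hG hedge).imp weaken fun h2 => ?_
    push_cast
    rwa [add_mul, one_mul]

/-- **The Kohayakawa–Rödl Sparse Regularity Lemma.**  For every `ε, D > 0` and every
integer `m ≥ 1` there are `η > 0` and a positive integer `M ≥ m` such that every
`(η,D)`-upper-uniform graph `G` with at least `M` vertices and at least one edge has an
`(ε)`-regular partition `𝒫 = V₀ ∪ V₁ ∪ ⋯ ∪ V_k` with exceptional set `V₀` and
`m ≤ k ≤ M`. -/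
theorem kohayakawa_rodl_sparse_regularity (ε D : ℝ) (hε : 0 < ε) (hD : 0 < D)
    (m : ℕ) (hm : 1 ≤ m) :
    ∃ (η : ℝ) (M : ℕ), 0 < η ∧ 0 < M ∧ m ≤ M ∧
      ∀ n : ℕ, M ≤ n → ∀ G : SimpleGraph (Fin n),
        UpperUniform G η D → (∃ x y, G.Adj x y) →
        ∃ (k : ℕ) (p : Fin n → Fin (k + 1)),
          m ≤ k ∧ k ≤ M ∧ ScaledEpsRegularGraphPartition G ε p := by
  set ε' := min ε (1 / 2) with hε'
  have h0 : 0 < ε' := lt_min hε (by norm_num)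
  obtain ⟨T, hT⟩ := exists_nat_gt (2 * D / (ε' ^ 5 / 4))
  rw [div_lt_iff₀ (by positivity)] at hT
  obtain ⟨η, β, M, hη, -, -, hmM, h⟩ :=
    regular_or_scored_partition h0 (min_le_right _ _) hD hm T
  refine ⟨η, M, hη, by omega, hmM, fun n hn G hG hedge => ?_⟩
  rcases h n hn G hG hedge with ⟨k, p, h1, h2, h3⟩ | ⟨k, c, p, t, -, -, -, -, -, ht, -, hg⟩
  · exact ⟨k, p, h1, h2, h3.mono (min_le_left _ _)⟩
  · exfalso
    have hn0 : (0 : ℝ) < n := by exact_mod_cast (by omega : 0 < n)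
    have hd := graphDensity_pos hedge
    have h1 := hg.trans (sum_score_le hD fun z => (ht z).2)
    exact absurd (le_of_mul_le_mul_right h1 (by positivity)) (not_le.2 hT)
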